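/- (Forward-backward Lemma) Let F be a fact base, 𝒬 a UCQ and R a disjunctive rule. For any trigger (R, h) on F, if α_∨(F, R, h) ⊨ 𝒬 then either F ⊨ 𝒬 or there is a disjunctive piece-unifier μ_∨ of 𝒬 with R such that F ⊨ β_∨(𝒬, R, μ_∨). -/

import Mathlib

/-! ## Basic syntax: terms, atoms, substitutions -/

/-- A term over variables `V` and constants `C`. -/
inductive FOTerm (V C : Type) where
  | var (v : V)
  | const (c : C)
deriving DecidableEq

/-- An atom `p(t_1,...,t_n)`. -/
structure FOAtom (P V C : Type) where
  pred : P
  args : List (FOTerm V C)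
deriving DecidableEq

/-- A substitution of variables by terms. -/
abbrev FOSubst (V C : Type) := V → FOTerm V C

variable {P V C : Type}

def FOTerm.applySub (u : FOSubst V C) : FOTerm V C → FOTerm V C
  | FOTerm.var v => u v
  | FOTerm.const c => FOTerm.const c

def FOAtom.applySub (u : FOSubst V C) (a : FOAtom P V C) : FOAtom P V C :=
  ⟨a.pred, a.args.map (FOTerm.applySub u)⟩

def applySubFS [DecidableEq P] [DecidableEq V] [DecidableEq C]
    (u : FOSubst V C) (S : Finset (FOAtom P V C)) : Finset (FOAtom P V C) :=
  S.image (FOAtom.applySub u)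

def FOTerm.varsOf [DecidableEq V] : FOTerm V C → Finset V
  | FOTerm.var v => {v}
  | FOTerm.const _ => ∅

def FOAtom.varsOf [DecidableEq V] (a : FOAtom P V C) : Finset V :=
  a.args.foldr (fun t acc => t.varsOf ∪ acc) ∅

/-- Variables occurring in a finite set of atoms. -/
def varsFS [DecidableEq V] (S : Finset (FOAtom P V C)) : Finset V :=
  S.sup FOAtom.varsOf

/-- Terms occurring in a finite set of atoms. -/
def termsFS [DecidableEq V] [DecidableEq C] (S : Finset (FOAtom P V C)) :
    Finset (FOTerm V C) :=
  S.sup (fun a => a.args.toFinset)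

/-- `h` is a homomorphism from the atom set `S₁` to the atom set `S₂`. -/
def IsHom (h : FOSubst V C) (S₁ S₂ : Finset (FOAtom P V C)) : Prop :=
  ∀ a ∈ S₁, a.applySub h ∈ S₂

/-- `S₂ ⊨ S₁` for atom sets viewed as existentially closed conjunctions:
there is a homomorphism from `S₁` to `S₂`. -/
def EntailsFS (S₂ S₁ : Finset (FOAtom P V C)) : Prop :=
  ∃ h : FOSubst V C, IsHom h S₁ S₂

/-! ## Disjunctive existential rules, triggers, chase step α -/

/-- A disjunctive existential rule `B → H₁ ∨ ... ∨ Hₙ`. -/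
structure DisjRule (P V C : Type) where
  body : Finset (FOAtom P V C)
  heads : List (Finset (FOAtom P V C))

/-- Well-formedness: non-empty body, at least one head disjunct, non-empty disjuncts. -/
def DisjRule.WF (R : DisjRule P V C) : Prop :=
  R.body.Nonempty ∧ R.heads ≠ [] ∧ ∀ H ∈ R.heads, H.Nonempty

/-- All variables of a rule. -/
def DisjRule.vars [DecidableEq V] (R : DisjRule P V C) : Finset V :=
  varsFS R.body ∪ R.heads.foldr (fun H acc => varsFS H ∪ acc) ∅

/-- A trigger `(R, h)` on `F`: `h` is a homomorphism from the body of `R` to `F`. -/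
def IsTrigger (R : DisjRule P V C) (h : FOSubst V C) (F : Finset (FOAtom P V C)) : Prop :=
  IsHom h R.body F

/-- `h'` is a safe extension of `h` for the head disjunct `H` of rule `R` w.r.t. the
fact base `F`: it agrees with `h` outside the existential variables of `H` and renames
the existential variables of `H` injectively to fresh variables. -/
def IsSafeExt [DecidableEq V] (F : Finset (FOAtom P V C)) (R : DisjRule P V C)
    (H : Finset (FOAtom P V C)) (h h' : FOSubst V C) : Prop :=
  (∀ v : V, v ∉ varsFS H \ varsFS R.body → h' v = h v) ∧
  (∀ v ∈ varsFS H \ varsFS R.body, ∃ w : V, h' v = FOTerm.var w ∧ w ∉ varsFS F) ∧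
  (∀ v ∈ varsFS H \ varsFS R.body, ∀ v' ∈ varsFS H \ varsFS R.body,
      h' v = h' v' → v = v')

/-- `L` is a result of the application `α_∨(F, R, h)` of the trigger `(R, h)` on `F`:
its `i`-th element is `F ∪ h^{safeᵢ}(Hᵢ)`. -/
def IsAlpha [DecidableEq P] [DecidableEq V] [DecidableEq C]
    (F : Finset (FOAtom P V C)) (R : DisjRule P V C) (h : FOSubst V C)
    (L : List (Finset (FOAtom P V C))) : Prop :=
  L.length = R.heads.length ∧
  ∀ (i : ℕ) (hi : i < L.length) (hi' : i < R.heads.length),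
    ∃ h' : FOSubst V C, IsSafeExt F R (R.heads.get ⟨i, hi'⟩) h h' ∧
      L.get ⟨i, hi⟩ = F ∪ applySubFS h' (R.heads.get ⟨i, hi'⟩)

/-! ## Partitions of terms (as equivalence relations), piece-unifiers -/

/-- A relation on terms, representing a partition of a set of terms (two terms are
related iff they belong to the same class). -/
abbrev TRel (V C : Type) := FOTerm V C → FOTerm V C → Prop

/-- Admissibility of a partition: no class contains two distinct constants. -/
def RelAdmissible (r : TRel V C) : Prop :=
  ∀ c c' : C, r (FOTerm.const c) (FOTerm.const c') → c = c'

/-- `u` is a substitution associated with the partition represented by `r`: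
it is constant on classes, maps each term to a member of its class (the selected term),
and gives priority to constants. -/
def IsAssocSub (r : TRel V C) (u : FOSubst V C) : Prop :=
  (∀ s t, r s t → s.applySub u = t.applySub u) ∧
  (∀ t, r t (t.applySub u)) ∧
  (∀ (v : V) (c : C), r (FOTerm.var v) (FOTerm.const c) → u v = FOTerm.const c)

/-- The data of a piece-unifier `(Q', H', P_u)`. -/
structure PieceUnif (P V C : Type) where
  Q' : Finset (FOAtom P V C)
  H' : Finset (FOAtom P V C)
  rel : TRel V C

/-- `μ` is a piece-unifier of the CQ `Q` with the conjunctive rule `B → H`. -/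
def IsPieceUnifier [DecidableEq P] [DecidableEq V] [DecidableEq C]
    (Q : Finset (FOAtom P V C)) (B H : Finset (FOAtom P V C))
    (μ : PieceUnif P V C) : Prop :=
  μ.Q'.Nonempty ∧ μ.Q' ⊆ Q ∧ μ.H' ⊆ H ∧
  Equivalence μ.rel ∧
  -- the partition is on the terms of Q' and H' (all other classes are singletons)
  (∀ s t, μ.rel s t → s = t ∨
      (s ∈ termsFS μ.Q' ∪ termsFS μ.H' ∧ t ∈ termsFS μ.Q' ∪ termsFS μ.H')) ∧
  RelAdmissible μ.rel ∧
  -- classes containing an existential variable of H' contain otherwise only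
  -- non-separating variables of Q'
  (∀ z ∈ varsFS μ.H' \ varsFS B, ∀ t, μ.rel (FOTerm.var z) t → t = FOTerm.var z ∨
      ∃ v : V, t = FOTerm.var v ∧ FOTerm.var v ∈ termsFS μ.Q' ∧ v ∉ varsFS (Q \ μ.Q')) ∧
  -- unification condition
  (∀ u : FOSubst V C, IsAssocSub μ.rel u → applySubFS u μ.Q' = applySubFS u μ.H')

/-- The join of a list of partitions (represented as relations): the equivalence
relation generated by their union. -/
def joinRel (rs : List (TRel V C)) : TRel V C :=
  Relation.EqvGen (fun s t => ∃ r ∈ rs, r s t)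

/-- The data of a disjunctive piece-unifier: the safe copies `Q₁, ..., Qₙ` together
with the conjunctive piece-unifiers `μ₁, ..., μₙ`. -/
structure DisjPieceUnif (P V C : Type) where
  Qs : List (Finset (FOAtom P V C))
  mus : List (PieceUnif P V C)

/-- The join of the partitions of a disjunctive piece-unifier. -/
def DisjPieceUnif.rel (μ : DisjPieceUnif P V C) : TRel V C :=
  joinRel (μ.mus.map PieceUnif.rel)

/-- `Qc` is a safe copy of `Q` (bijective renaming of its variables). -/
def IsSafeCopy [DecidableEq P] [DecidableEq V] [DecidableEq C]
    (Q Qc : Finset (FOAtom P V C)) : Prop :=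
  ∃ ρ : V → V, Function.Injective ρ ∧
    Qc = Q.image (FOAtom.applySub (fun v => FOTerm.var (ρ v)))

/-- `μ` is a disjunctive piece-unifier of the UCQ `𝒬` with the disjunctive rule `R`. -/
def IsDisjPieceUnifier [DecidableEq P] [DecidableEq V] [DecidableEq C]
    (𝒬 : Set (Finset (FOAtom P V C))) (R : DisjRule P V C)
    (μ : DisjPieceUnif P V C) : Prop :=
  μ.Qs.length = R.heads.length ∧ μ.mus.length = R.heads.length ∧
  -- each Qᵢ is a safe copy of a CQ of 𝒬, with variables disjoint from the rule
  -- and from the other copies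
  (∀ (i : ℕ) (hi : i < μ.Qs.length), ∃ Q ∈ 𝒬, IsSafeCopy Q (μ.Qs.get ⟨i, hi⟩)) ∧
  (∀ (i : ℕ) (hi : i < μ.Qs.length), Disjoint (varsFS (μ.Qs.get ⟨i, hi⟩)) R.vars) ∧
  (∀ (i j : ℕ) (hi : i < μ.Qs.length) (hj : j < μ.Qs.length), i ≠ j →
      Disjoint (varsFS (μ.Qs.get ⟨i, hi⟩)) (varsFS (μ.Qs.get ⟨j, hj⟩))) ∧
  -- each μᵢ is a piece-unifier of Qᵢ with B → Hᵢ
  (∀ (i : ℕ) (hi : i < R.heads.length) (hi1 : i < μ.Qs.length) (hi2 : i < μ.mus.length),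
      IsPieceUnifier (μ.Qs.get ⟨i, hi1⟩) R.body (R.heads.get ⟨i, hi⟩)
        (μ.mus.get ⟨i, hi2⟩)) ∧
  -- the join of the partitions is admissible
  RelAdmissible μ.rel

/-- `β_∨(𝒬, R, μ) = u(B) ∪ ⋃ᵢ u(Qᵢ ∖ Qᵢ')`, for `u` a substitution associated with
the join of the partitions of `μ`. -/
def betaRw [DecidableEq P] [DecidableEq V] [DecidableEq C]
    (R : DisjRule P V C) (μ : DisjPieceUnif P V C) (u : FOSubst V C) :
    Finset (FOAtom P V C) :=
  applySubFS u R.body ∪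
    (List.zipWith (fun Qi m => applySubFS u (Qi \ PieceUnif.Q' m)) μ.Qs μ.mus).foldr
      (· ∪ ·) ∅

/-! ## Semantics -/

/-- A first-order interpretation (with non-empty domain). -/
structure Interp (P V C : Type) where
  dom : Type
  nonempty : Nonempty dom
  rel : P → List dom → Prop
  cst : C → dom

def Interp.evalT (I : Interp P V C) (a : V → I.dom) : FOTerm V C → I.dom
  | FOTerm.var v => a v
  | FOTerm.const c => I.cst c

def Interp.satAtom (I : Interp P V C) (a : V → I.dom) (atm : FOAtom P V C) : Prop :=
  I.rel atm.pred (atm.args.map (I.evalT a))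

def Interp.satFS (I : Interp P V C) (a : V → I.dom) (S : Finset (FOAtom P V C)) : Prop :=
  ∀ atm ∈ S, I.satAtom a atm

/-- `I` is a model of the atom set `S` viewed as an existentially closed conjunction. -/
def Interp.modelsFB [DecidableEq V] (I : Interp P V C) (S : Finset (FOAtom P V C)) : Prop :=
  ∃ a : V → I.dom, I.satFS a S

/-- `I` satisfies the disjunctive existential rule `R`. -/
def Interp.satRule [DecidableEq V] (I : Interp P V C) (R : DisjRule P V C) : Prop :=
  ∀ a : V → I.dom, I.satFS a R.body →
    ∃ H ∈ R.heads, ∃ a' : V → I.dom,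
      (∀ v ∈ varsFS R.body, a' v = a v) ∧ I.satFS a' H

/-- First-order entailment `F, ℛ ⊨ 𝒬` of a UCQ from a fact base and a set of
disjunctive existential rules. -/
def SemEntails [DecidableEq V] (F : Finset (FOAtom P V C)) (ℛ : Set (DisjRule P V C))
    (𝒬 : Set (Finset (FOAtom P V C))) : Prop :=
  ∀ I : Interp P V C, I.modelsFB F → (∀ R ∈ ℛ, I.satRule R) →
    ∃ Q ∈ 𝒬, I.modelsFB Q

/-! ## Piece-rewriting -/

/-- `IsPieceRewriting ℛ 𝒬 𝒬'` holds when the UCQ `𝒬'` is obtained from the UCQ `𝒬`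
by a finite sequence of one-step piece-rewritings with rules of `ℛ`. -/
inductive IsPieceRewriting [DecidableEq P] [DecidableEq V] [DecidableEq C]
    (ℛ : Set (DisjRule P V C)) :
    Finset (Finset (FOAtom P V C)) → Finset (Finset (FOAtom P V C)) → Prop
  | refl (𝒬 : Finset (Finset (FOAtom P V C))) : IsPieceRewriting ℛ 𝒬 𝒬
  | step (𝒬 𝒬' : Finset (Finset (FOAtom P V C))) (R : DisjRule P V C)
      (μ : DisjPieceUnif P V C) (u : FOSubst V C) :
      IsPieceRewriting ℛ 𝒬 𝒬' → R ∈ ℛ →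
      IsDisjPieceUnifier (↑𝒬' : Set (Finset (FOAtom P V C))) R μ →
      IsAssocSub μ.rel u →
      IsPieceRewriting ℛ 𝒬 (insert (betaRw R μ u) 𝒬')

/-! ## Auxiliary facts -/

lemma FOTerm.mem_varsOf [DecidableEq V]
    {v : V} {t : FOTerm V C} : v ∈ t.varsOf ↔ t = FOTerm.var v := by
  cases t <;> simp [FOTerm.varsOf, eq_comm]

lemma FOAtom.mem_varsOf [DecidableEq V] {v : V} {a : FOAtom P V C} :
    v ∈ a.varsOf ↔ FOTerm.var v ∈ a.args := by
  obtain ⟨p, l⟩ := a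
  simp only [FOAtom.varsOf]
  induction l with
  | nil => simp
  | cons t l ih => simp [ih, FOTerm.mem_varsOf, eq_comm]

lemma mem_varsFS [DecidableEq V] {v : V} {S : Finset (FOAtom P V C)} :
    v ∈ varsFS S ↔ ∃ a ∈ S, FOTerm.var v ∈ a.args := by
  simp [varsFS, Finset.mem_sup, FOAtom.mem_varsOf]

lemma mem_termsFS [DecidableEq V] [DecidableEq C] {t : FOTerm V C} {S : Finset (FOAtom P V C)} :
    t ∈ termsFS S ↔ ∃ a ∈ S, t ∈ a.args := by
  simp [termsFS, Finset.mem_sup]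

lemma var_mem_termsFS [DecidableEq V] [DecidableEq C] {v : V} {S : Finset (FOAtom P V C)} :
    FOTerm.var v ∈ termsFS S ↔ v ∈ varsFS S := by
  rw [mem_termsFS, mem_varsFS]

lemma termsFS_mono [DecidableEq V] [DecidableEq C]
    {S T : Finset (FOAtom P V C)} (hST : S ⊆ T) : termsFS S ⊆ termsFS T :=
  Finset.sup_mono hST

lemma varsFS_subset_vars_of_mem_heads [DecidableEq V]
    {R : DisjRule P V C} {H : Finset (FOAtom P V C)}
    (hH : H ∈ R.heads) : varsFS H ⊆ R.vars := by
  have key : ∀ l : List (Finset (FOAtom P V C)), H ∈ l →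
      varsFS H ⊆ l.foldr (fun H acc => varsFS H ∪ acc) ∅ := by
    intro l hl
    induction l with
    | nil => simp at hl
    | cons K l ih =>
      rcases List.mem_cons.1 hl with rfl | hl
      · exact Finset.subset_union_left
      · exact (ih hl).trans Finset.subset_union_right
  exact (key _ hH).trans Finset.subset_union_right

lemma varsFS_body_subset_vars [DecidableEq V] (R : DisjRule P V C) : varsFS R.body ⊆ R.vars :=
  Finset.subset_union_left

lemma FOAtom.applySub_eq_iff {u u' : FOSubst V C} {a b : FOAtom P V C} :
    a.applySub u = b.applySub u' ↔
      a.pred = b.pred ∧ a.args.map (FOTerm.applySub u) = b.args.map (FOTerm.applySub u') := by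
  simp [FOAtom.applySub]

lemma mem_termsFS_applySub [DecidableEq V] [DecidableEq C]
    {g : FOSubst V C} {a : FOAtom P V C} {F : Finset (FOAtom P V C)}
    (ha : a.applySub g ∈ F) {t : FOTerm V C} (ht : t ∈ a.args) : t.applySub g ∈ termsFS F :=
  mem_termsFS.2 ⟨_, ha, List.mem_map_of_mem ht⟩

/-- Every admissible equivalence relation on terms has an associated substitution. -/
lemma exists_isAssocSub {r : TRel V C} (hr : Equivalence r) (hadm : RelAdmissible r) :
    ∃ u : FOSubst V C, IsAssocSub r u := by
  classical
  let S : Setoid (FOTerm V C) := ⟨r, hr⟩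
  let u : FOSubst V C := fun v =>
    if hc : ∃ c, r (FOTerm.var v) (FOTerm.const c) then FOTerm.const hc.choose
    else (Quotient.mk S (FOTerm.var v)).out
  have u_const : ∀ v c, r (FOTerm.var v) (FOTerm.const c) → u v = FOTerm.const c := by
    intro v c hvc
    have hc : ∃ c, r (FOTerm.var v) (FOTerm.const c) := ⟨c, hvc⟩
    simp only [u, dif_pos hc, FOTerm.const.injEq]
    exact hadm _ _ (hr.trans (hr.symm hc.choose_spec) hvc)
  refine ⟨u, ?_, ?_, u_const⟩
  · rintro (v | c) (w | d) hst
    · by_cases hc : ∃ c, r (FOTerm.var v) (FOTerm.const c)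
      · obtain ⟨c, hc⟩ := hc
        exact (u_const v c hc).trans (u_const w c (hr.trans (hr.symm hst) hc)).symm
      · have hc' : ¬ ∃ c, r (FOTerm.var w) (FOTerm.const c) :=
          fun ⟨c, hwc⟩ => hc ⟨c, hr.trans hst hwc⟩
        simp only [FOTerm.applySub, u, dif_neg hc, dif_neg hc']
        exact congrArg Quotient.out (Quotient.sound (s := S) hst)
    · exact u_const v d hst
    · exact (u_const w c (hr.symm hst)).symm
    · exact congrArg FOTerm.const (hadm _ _ hst)
  · rintro (v | c)
    · by_cases hc : ∃ c, r (FOTerm.var v) (FOTerm.const c)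
      · simp only [FOTerm.applySub, u, dif_pos hc]
        exact hc.choose_spec
      · simp only [FOTerm.applySub, u, dif_neg hc]
        exact hr.symm (Quotient.mk_out (s := S) (FOTerm.var v))
    · exact hr.refl _

/-- A family of injective renamings with pairwise disjoint ranges avoiding a finite set. -/
lemma exists_fresh_renamings [Infinite V] (A : Finset V) :
    ∃ ρ : ℕ → V → V, (∀ i, Function.Injective (ρ i)) ∧ (∀ i v, ρ i v ∉ A) ∧
      ∀ i j v w, ρ i v = ρ j w → i = j := by
  have hcard : Cardinal.mk (V × ℕ) = Cardinal.mk V := by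
    simp [Cardinal.mk_prod, Cardinal.mul_aleph0_eq (Cardinal.aleph0_le_mk V)]
  obtain ⟨e⟩ := Cardinal.eq.1 hcard
  refine ⟨fun i v => e (v, A.sup (fun x => (e.symm x).2) + 1 + i), ?_, ?_, ?_⟩
  · intro i v w hvw
    simpa using hvw
  · intro i v hv
    have := Finset.le_sup (f := fun x => (e.symm x).2) hv
    simp only [Equiv.symm_apply_apply] at this
    omega
  · intro i j v w hvw
    simp only [EmbeddingLike.apply_eq_iff_eq, Prod.mk.injEq] at hvw
    omega

/-- Label a term by the element of `E` that `h'` maps to it, if any, and by itself otherwise. -/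
noncomputable def preimageLabel [DecidableEq V] [DecidableEq C]
    (E : Finset V) (h' : FOSubst V C) (t : FOTerm V C) :
    FOTerm V C ⊕ V :=
  open Classical in
  if hz : ∃ z ∈ E, h' z = t then Sum.inr hz.choose else Sum.inl t

lemma preimageLabel_injective [DecidableEq V] [DecidableEq C] (E : Finset V) (h' : FOSubst V C) :
    Function.Injective (preimageLabel E h') := by
  intro s t hst
  by_cases hs : ∃ z ∈ E, h' z = s <;> by_cases ht : ∃ z ∈ E, h' z = t
  · simp only [preimageLabel, dif_pos hs, dif_pos ht, Sum.inr.injEq] at hst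
    rw [← hs.choose_spec.2, ← ht.choose_spec.2, hst]
  all_goals simp_all [preimageLabel]

lemma preimageLabel_of_notMem [DecidableEq V] [DecidableEq C]
    {E : Finset V} {h' : FOSubst V C} {t : FOTerm V C}
    (ht : ∀ z ∈ E, h' z ≠ t) : preimageLabel E h' t = Sum.inl t :=
  dif_neg fun ⟨z, hz, hzt⟩ => ht z hz hzt

lemma preimageLabel_apply [DecidableEq V] [DecidableEq C] {E : Finset V} {h' : FOSubst V C}
    (hinj : ∀ v ∈ E, ∀ w ∈ E, h' v = h' w → v = w) {z : V} (hz : z ∈ E) :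
    preimageLabel E h' (h' z) = Sum.inr z := by
  have hex : ∃ y ∈ E, h' y = h' z := ⟨z, hz, rfl⟩
  rw [preimageLabel, dif_pos hex, hinj _ hex.choose_spec.1 _ hz hex.choose_spec.2]

lemma IsSafeExt.ne_of_mem_termsFS [DecidableEq V] [DecidableEq C]
    {F : Finset (FOAtom P V C)} {R : DisjRule P V C}
    {H : Finset (FOAtom P V C)} {h h' : FOSubst V C} (hs : IsSafeExt F R H h h')
    {t : FOTerm V C} (ht : t ∈ termsFS F) {z : V} (hz : z ∈ varsFS H \ varsFS R.body) :
    h' z ≠ t := by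
  obtain ⟨w, hw, hwF⟩ := hs.2.1 z hz
  rintro rfl
  rw [hw, var_mem_termsFS] at ht
  exact hwF ht

lemma IsSafeExt.preimageLabel_of_mem_termsFS [DecidableEq V] [DecidableEq C]
    {F : Finset (FOAtom P V C)} {R : DisjRule P V C}
    {H : Finset (FOAtom P V C)} {h h' : FOSubst V C} (hs : IsSafeExt F R H h h')
    {t : FOTerm V C} (ht : t ∈ termsFS F) :
    preimageLabel (varsFS H \ varsFS R.body) h' t = Sum.inl t :=
  preimageLabel_of_notMem fun _ => hs.ne_of_mem_termsFS ht

lemma IsSafeExt.preimageLabel_const [DecidableEq V] [DecidableEq C]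
    {F : Finset (FOAtom P V C)} {R : DisjRule P V C}
    {H : Finset (FOAtom P V C)} {h h' : FOSubst V C} (hs : IsSafeExt F R H h h') (c : C) :
    preimageLabel (varsFS H \ varsFS R.body) h' (FOTerm.const c) = Sum.inl (FOTerm.const c) :=
  preimageLabel_of_notMem fun z hz => by
    obtain ⟨w, hw, -⟩ := hs.2.1 z hz
    simp [hw]

lemma IsTrigger.mem_termsFS [DecidableEq V] [DecidableEq C]
    {F : Finset (FOAtom P V C)} {R : DisjRule P V C}
    {h : FOSubst V C} (htrig : IsTrigger R h F) {x : V} (hx : x ∈ varsFS R.body) :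
    h x ∈ termsFS F := by
  obtain ⟨a, ha, hxa⟩ := mem_varsFS.1 hx
  exact mem_termsFS_applySub (htrig a ha) hxa

/-- The partition of the terms of `Q'` and `H'` into the fibres of `Φ`. -/
def fibreUnif [DecidableEq V] [DecidableEq C]
    {X : Type} (Φ : FOTerm V C → X) (Q' H' : Finset (FOAtom P V C)) :
    PieceUnif P V C where
  Q' := Q'
  H' := H'
  rel s t := s = t ∨
    (s ∈ termsFS Q' ∪ termsFS H' ∧ t ∈ termsFS Q' ∪ termsFS H') ∧ Φ s = Φ t

lemma fibreUnif_rel_equivalence [DecidableEq V] [DecidableEq C] {X : Type} (Φ : FOTerm V C → X)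
    (Q' H' : Finset (FOAtom P V C)) : Equivalence (fibreUnif Φ Q' H').rel where
  refl _ := Or.inl rfl
  symm := by
    rintro s t (rfl | ⟨⟨hs, ht⟩, hst⟩)
    · exact Or.inl rfl
    · exact Or.inr ⟨⟨ht, hs⟩, hst.symm⟩
  trans := by
    rintro s t w (rfl | ⟨⟨hs, ht⟩, hst⟩) (rfl | ⟨⟨ht', hw⟩, htw⟩)
    · exact Or.inl rfl
    · exact Or.inr ⟨⟨ht', hw⟩, htw⟩
    · exact Or.inr ⟨⟨hs, ht⟩, hst⟩
    · exact Or.inr ⟨⟨hs, hw⟩, hst.trans htw⟩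

lemma fibreUnif_rel_eq [DecidableEq V] [DecidableEq C]
    {X : Type} {Φ : FOTerm V C → X} {Q' H' : Finset (FOAtom P V C)}
    {s t : FOTerm V C} (hst : (fibreUnif Φ Q' H').rel s t) : Φ s = Φ t := by
  rcases hst with rfl | ⟨-, hst⟩
  exacts [rfl, hst]

/-- An associated substitution of the fibre partition unifies atoms with equal images. -/
lemma applySub_eq_of_fibreUnif [DecidableEq V] [DecidableEq C]
    {X : Type} {Φ : FOTerm V C → X} {Q' H' : Finset (FOAtom P V C)}
    {u : FOSubst V C} (hu : IsAssocSub (fibreUnif Φ Q' H').rel u) {a b : FOAtom P V C}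
    (ha : a ∈ Q') (hb : b ∈ H') (hpred : a.pred = b.pred)
    (hargs : a.args.map Φ = b.args.map Φ) : a.applySub u = b.applySub u := by
  rw [FOAtom.applySub_eq_iff]
  refine ⟨hpred, ?_⟩
  have hlen : a.args.length = b.args.length := by simpa using congrArg List.length hargs
  refine List.ext_getElem (by simpa using hlen) fun k hk hk' => ?_
  simp only [List.length_map] at hk hk'
  simp only [List.getElem_map]
  refine hu.1 _ _ (Or.inr ⟨⟨?_, ?_⟩, ?_⟩)
  · exact Finset.mem_union_left _ (mem_termsFS.2 ⟨a, ha, List.getElem_mem hk⟩)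
  · exact Finset.mem_union_right _ (mem_termsFS.2 ⟨b, hb, List.getElem_mem hk'⟩)
  · have := List.getElem_of_eq hargs (i := k) (by simpa using hk)
    simpa using this

/-- A homomorphism from `Q` to `F ∪ h'(H)` that does not map `Q` to `F` induces a
piece-unifier of `Q` with `R.body → H`. -/
lemma exists_isPieceUnifier [DecidableEq P] [DecidableEq V] [DecidableEq C]
    {X : Type} {F : Finset (FOAtom P V C)} {R : DisjRule P V C}
    {H : Finset (FOAtom P V C)} {h h' : FOSubst V C} (htrig : IsTrigger R h F)
    (hs : IsSafeExt F R H h h') {Q : Finset (FOAtom P V C)} {g : FOSubst V C}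
    (hg : IsHom g Q (F ∪ applySubFS h' H)) (hgF : ¬ IsHom g Q F)
    {Φ : FOTerm V C → X} {N : FOTerm V C → X} (hN : Function.Injective N)
    (hc : ∀ c c', Φ (FOTerm.const c) = Φ (FOTerm.const c') → c = c')
    (hH : ∀ t ∈ termsFS H, Φ t = N (t.applySub h'))
    (hQ : ∀ t ∈ termsFS Q, Φ t = N (t.applySub g)) :
    ∃ μ : PieceUnif P V C, IsPieceUnifier Q R.body H μ ∧
      (∀ s t, μ.rel s t → Φ s = Φ t) ∧ IsHom g (Q \ μ.Q') F := by
  classical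
  let Q' := Q.filter fun a => a.applySub g ∉ F
  let H' := H.filter fun b => ∃ a ∈ Q', a.applySub g = b.applySub h'
  have hQ'Q : Q' ⊆ Q := Finset.filter_subset _ _
  have hH'H : H' ⊆ H := Finset.filter_subset _ _
  have hrest : IsHom g (Q \ Q') F := by
    intro a ha
    by_contra hna
    exact (Finset.mem_sdiff.1 ha).2 (Finset.mem_filter.2 ⟨(Finset.mem_sdiff.1 ha).1, hna⟩)
  have hmatch : ∀ a ∈ Q', ∃ b ∈ H', a.applySub g = b.applySub h' := by
    intro a ha
    obtain ⟨haQ, haF⟩ := Finset.mem_filter.1 ha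
    rcases Finset.mem_union.1 (hg a haQ) with hmem | hmem
    · exact absurd hmem haF
    · obtain ⟨b, hb, hba⟩ := Finset.mem_image.1 hmem
      exact ⟨b, Finset.mem_filter.2 ⟨hb, a, ha, hba.symm⟩, hba.symm⟩
  have hunif : ∀ u, IsAssocSub (fibreUnif Φ Q' H').rel u → ∀ a ∈ Q', ∀ b ∈ H',
      a.applySub g = b.applySub h' → a.applySub u = b.applySub u := by
    intro u hu a ha b hb hab
    obtain ⟨hpred, hargs⟩ := FOAtom.applySub_eq_iff.1 hab
    refine applySub_eq_of_fibreUnif hu ha hb hpred ?_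
    have hΦa : a.args.map Φ = (a.args.map (FOTerm.applySub g)).map N := by
      simpa using fun t ht => hQ t (mem_termsFS.2 ⟨a, hQ'Q ha, ht⟩)
    have hΦb : b.args.map Φ = (b.args.map (FOTerm.applySub h')).map N := by
      simpa using fun t ht => hH t (mem_termsFS.2 ⟨b, hH'H hb, ht⟩)
    rw [hΦa, hΦb, hargs]
  refine ⟨fibreUnif Φ Q' H', ⟨?_, hQ'Q, hH'H, fibreUnif_rel_equivalence Φ Q' H', ?_,
    fun c c' hcc => hc c c' (fibreUnif_rel_eq hcc), ?_, ?_⟩, fun s t => fibreUnif_rel_eq, hrest⟩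
  · simp only [IsHom, not_forall] at hgF
    obtain ⟨a, haQ, haF⟩ := hgF
    exact ⟨a, Finset.mem_filter.2 ⟨haQ, haF⟩⟩
  · rintro s t (hst | ⟨hst, -⟩)
    exacts [Or.inl hst, Or.inr hst]
  · intro z hz t hzt
    obtain ⟨hzH', hzB⟩ := Finset.mem_sdiff.1 hz
    have hzH : FOTerm.var z ∈ termsFS H :=
      termsFS_mono hH'H (var_mem_termsFS.2 hzH')
    have hzE : z ∈ varsFS H \ varsFS R.body :=
      Finset.mem_sdiff.2 ⟨var_mem_termsFS.1 hzH, hzB⟩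
    obtain ⟨w, hw, hwF⟩ := hs.2.1 z hzE
    rcases hzt with hzt | ⟨⟨-, ht⟩, hΦ⟩
    · exact Or.inl hzt.symm
    rw [hH _ hzH] at hΦ
    rcases Finset.mem_union.1 ht with ht | ht
    · rw [hQ _ (termsFS_mono hQ'Q ht)] at hΦ
      have heq : h' z = t.applySub g := hN hΦ
      cases t with
      | const c => simp [hw, FOTerm.applySub] at heq
      | var v =>
        refine Or.inr ⟨v, rfl, ht, fun hv => ?_⟩
        obtain ⟨a, ha, hva⟩ := mem_varsFS.1 hv
        exact hs.ne_of_mem_termsFS (mem_termsFS_applySub (hrest a ha) hva) hzE heq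
    · rw [hH _ (termsFS_mono hH'H ht)] at hΦ
      have heq : h' z = t.applySub h' := hN hΦ
      cases t with
      | const c => simp [hw, FOTerm.applySub] at heq
      | var v =>
        by_cases hv : v ∈ varsFS R.body
        · have hvh : h' v = h v := hs.1 v fun hmem => (Finset.mem_sdiff.1 hmem).2 hv
          exact absurd (heq.trans hvh) (hs.ne_of_mem_termsFS (htrig.mem_termsFS hv) hzE)
        · have hvE : v ∈ varsFS H \ varsFS R.body :=
            Finset.mem_sdiff.2 ⟨var_mem_termsFS.1 (termsFS_mono hH'H ht), hv⟩
          exact Or.inl (congrArg FOTerm.var (hs.2.2 z hzE v hvE heq).symm)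
  · intro u hu
    ext x
    simp only [applySubFS, Finset.mem_image]
    constructor
    · rintro ⟨a, ha, rfl⟩
      obtain ⟨b, hb, hab⟩ := hmatch a ha
      exact ⟨b, hb, (hunif u hu a ha b hb hab).symm⟩
    · rintro ⟨b, hb, rfl⟩
      obtain ⟨a, ha, hab⟩ := (Finset.mem_filter.1 hb).2
      exact ⟨a, ha, hunif u hu a ha b hb hab⟩

/-- A labelling of terms that agrees, for each head disjunct, with the labelling induced by the
safe extension on the head and by the homomorphism on the query copy. -/
lemma exists_common_labelling [DecidableEq V] [DecidableEq C]
    {F : Finset (FOAtom P V C)} {R : DisjRule P V C}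
    {h : FOSubst V C} (htrig : IsTrigger R h F)
    {h' g : Fin R.heads.length → FOSubst V C} (hs : ∀ i, IsSafeExt F R (R.heads.get i) h (h' i))
    {Q : Fin R.heads.length → Finset (FOAtom P V C)}
    (hQR : ∀ i, Disjoint (varsFS (Q i)) R.vars)
    (hQQ : ∀ i j, i ≠ j → Disjoint (varsFS (Q i)) (varsFS (Q j))) :
    ∃ Φ : FOTerm V C → FOTerm V C ⊕ V,
      (∀ c, Φ (FOTerm.const c) = Sum.inl (FOTerm.const c)) ∧
      (∀ x ∈ varsFS R.body, Φ (FOTerm.var x) = Sum.inl (h x)) ∧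
      ∀ i, (∀ t ∈ termsFS (R.heads.get i), Φ t =
          preimageLabel (varsFS (R.heads.get i) \ varsFS R.body) (h' i) (t.applySub (h' i))) ∧
        ∀ t ∈ termsFS (Q i), Φ t =
          preimageLabel (varsFS (R.heads.get i) \ varsFS R.body) (h' i) (t.applySub (g i)) := by
  classical
  let φ : V → FOTerm V C ⊕ V := fun y =>
    if hy : ∃ i, y ∈ varsFS (Q i) then
      preimageLabel (varsFS (R.heads.get hy.choose) \ varsFS R.body) (h' hy.choose)
        (g hy.choose y)
    else if y ∈ varsFS R.body then Sum.inl (h y) else Sum.inr y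
  have hφR : ∀ x ∈ R.vars, φ x = if x ∈ varsFS R.body then Sum.inl (h x) else Sum.inr x :=
    fun x hx => dif_neg fun ⟨i, hi⟩ => Finset.disjoint_left.1 (hQR i) hi hx
  refine ⟨fun t => match t with
    | FOTerm.var v => φ v
    | FOTerm.const c => Sum.inl (FOTerm.const c), fun _ => rfl, fun x hx => ?_,
    fun i => ⟨?_, ?_⟩⟩
  · exact (hφR x (varsFS_body_subset_vars R hx)).trans (if_pos hx)
  · rintro (v | c) ht
    · have hv : v ∈ varsFS (R.heads.get i) := var_mem_termsFS.1 ht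
      simp only [FOTerm.applySub]
      rw [hφR v (varsFS_subset_vars_of_mem_heads (List.get_mem _ _) hv)]
      split_ifs with hvB
      · have hvh : h' i v = h v := (hs i).1 v fun hmem => (Finset.mem_sdiff.1 hmem).2 hvB
        rw [hvh, (hs i).preimageLabel_of_mem_termsFS (htrig.mem_termsFS hvB)]
      · rw [preimageLabel_apply (hs i).2.2 (Finset.mem_sdiff.2 ⟨hv, hvB⟩)]
    · exact ((hs i).preimageLabel_const c).symm
  · rintro (v | c) ht
    · have hv : v ∈ varsFS (Q i) := var_mem_termsFS.1 ht
      have hex : ∃ j, v ∈ varsFS (Q j) := ⟨i, hv⟩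
      have hchoose : hex.choose = i := by
        by_contra hne
        exact Finset.disjoint_left.1 (hQQ _ _ hne) hex.choose_spec hv
      simp only [FOTerm.applySub, φ, dif_pos hex, hchoose]
    · exact ((hs i).preimageLabel_const c).symm

lemma joinRel_equivalence (rs : List (TRel V C)) : Equivalence (joinRel rs) :=
  Relation.EqvGen.is_equivalence _

lemma joinRel_le_fibres {X : Type} {Φ : FOTerm V C → X} {rs : List (TRel V C)}
    (hrs : ∀ r ∈ rs, ∀ s t, r s t → Φ s = Φ t) {s t : FOTerm V C} (hst : joinRel rs s t) :
    Φ s = Φ t := by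
  induction hst with
  | rel s t hst =>
    obtain ⟨r, hr, hst⟩ := hst
    exact hrs r hr s t hst
  | refl => rfl
  | symm _ _ _ ih => exact ih.symm
  | trans _ _ _ _ _ ih ih' => exact ih.trans ih'

lemma mem_foldr_union {α : Type} [DecidableEq α] {l : List (Finset α)} {x : α} :
    x ∈ l.foldr (· ∪ ·) ∅ ↔ ∃ s ∈ l, x ∈ s := by
  induction l with
  | nil => simp
  | cons s l ih => simp [ih]

lemma mem_betaRw_ofFn [DecidableEq P] [DecidableEq V] [DecidableEq C]
    {R : DisjRule P V C} {n : ℕ} {Q : Fin n → Finset (FOAtom P V C)}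
    {m : Fin n → PieceUnif P V C} {u : FOSubst V C} {a : FOAtom P V C} :
    a ∈ betaRw R ⟨List.ofFn Q, List.ofFn m⟩ u ↔
      a ∈ applySubFS u R.body ∨ ∃ i, a ∈ applySubFS u (Q i \ (m i).Q') := by
  rw [betaRw, Finset.mem_union, mem_foldr_union]
  refine or_congr_right ?_
  constructor
  · rintro ⟨s, hs, ha⟩
    obtain ⟨k, hk, rfl⟩ := List.mem_iff_getElem.1 hs
    have hkn : k < n := by simpa using hk
    exact ⟨⟨k, hkn⟩, by simpa using ha⟩
  · rintro ⟨i, ha⟩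
    exact ⟨_, List.mem_iff_getElem.2 ⟨i, by simp, rfl⟩, by simpa using ha⟩

/-- Homomorphisms from pairwise disjoint query copies to the fact bases produced by a trigger
yield a disjunctive piece-unifier whose rewriting is entailed by the original fact base. -/
lemma exists_disjPieceUnifier_of_copies [DecidableEq P] [DecidableEq V] [DecidableEq C]
    {F : Finset (FOAtom P V C)}
    {𝒬 : Set (Finset (FOAtom P V C))} {R : DisjRule P V C} {h : FOSubst V C}
    (htrig : IsTrigger R h F) {h' g : Fin R.heads.length → FOSubst V C}
    (hs : ∀ i, IsSafeExt F R (R.heads.get i) h (h' i))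
    {Q : Fin R.heads.length → Finset (FOAtom P V C)}
    (hcopy : ∀ i, ∃ Q₀ ∈ 𝒬, IsSafeCopy Q₀ (Q i))
    (hQR : ∀ i, Disjoint (varsFS (Q i)) R.vars)
    (hQQ : ∀ i j, i ≠ j → Disjoint (varsFS (Q i)) (varsFS (Q j)))
    (hg : ∀ i, IsHom (g i) (Q i) (F ∪ applySubFS (h' i) (R.heads.get i)))
    (hgF : ∀ i, ¬ IsHom (g i) (Q i) F) :
    ∃ μ : DisjPieceUnif P V C, IsDisjPieceUnifier 𝒬 R μ ∧
      ∃ u : FOSubst V C, IsAssocSub μ.rel u ∧ EntailsFS F (betaRw R μ u) := by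
  obtain ⟨Φ, hΦc, hΦB, hΦ⟩ := exists_common_labelling htrig (g := g) hs hQR hQQ
  have hΦinj : ∀ c c', Φ (FOTerm.const c) = Φ (FOTerm.const c') → c = c' := by
    intro c c' hcc
    simpa [hΦc] using hcc
  choose m hm hmΦ hmF using fun i => exists_isPieceUnifier htrig (hs i) (hg i) (hgF i)
    (preimageLabel_injective _ _) hΦinj (hΦ i).1 (hΦ i).2
  let μ : DisjPieceUnif P V C := ⟨List.ofFn Q, List.ofFn m⟩
  have hrel : ∀ s t, μ.rel s t → Φ s = Φ t := by
    refine fun s t => joinRel_le_fibres fun r hr => ?_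
    obtain ⟨ν, hν, rfl⟩ := List.mem_map.1 hr
    obtain ⟨i, rfl⟩ := List.mem_ofFn.1 hν
    exact hmΦ i
  have hadm : RelAdmissible μ.rel := fun c c' hcc => hΦinj c c' (hrel _ _ hcc)
  obtain ⟨u, hu⟩ := exists_isAssocSub (joinRel_equivalence _) hadm
  refine ⟨μ, ⟨by simp [μ], by simp [μ], ?_, ?_, ?_, ?_, hadm⟩, u, hu,
    fun v => Sum.elim id (fun w => FOTerm.var w) (Φ (FOTerm.var v)), ?_⟩
  · intro i hi
    simpa [μ] using hcopy ⟨i, by simpa [μ] using hi⟩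
  · intro i hi
    simpa [μ] using hQR ⟨i, by simpa [μ] using hi⟩
  · intro i j hi hj hij
    simpa [μ] using hQQ ⟨i, by simpa [μ] using hi⟩ ⟨j, by simpa [μ] using hj⟩ (by simpa using hij)
  · intro i hi _ _
    simpa [μ] using hm ⟨i, hi⟩
  · have hfactor : ∀ (S : Finset (FOAtom P V C)) (k : FOSubst V C), IsHom k S F →
        (∀ v ∈ varsFS S, Φ (FOTerm.var v) = Sum.inl (k v)) → ∀ a ∈ applySubFS u S,
        a.applySub (fun v => Sum.elim id (fun w => FOTerm.var w) (Φ (FOTerm.var v))) ∈ F := by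
      intro S k hk hkΦ a ha
      obtain ⟨b, hb, rfl⟩ := Finset.mem_image.1 ha
      have happly : ∀ t : FOTerm V C,
          t.applySub (fun v => Sum.elim id (fun w => FOTerm.var w) (Φ (FOTerm.var v))) =
            Sum.elim id (fun w => FOTerm.var w) (Φ t) := by
        rintro (v | c)
        · rfl
        · simp [FOTerm.applySub, hΦc]
      convert hk b hb using 1
      simp only [FOAtom.applySub, List.map_map, FOAtom.mk.injEq, true_and]
      refine List.map_congr_left fun t ht => ?_
      rw [Function.comp_apply, happly, ← hrel _ _ (hu.2.1 t)]
      cases t with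
      | const c => simp [FOTerm.applySub, hΦc]
      | var v => simp [FOTerm.applySub, hkΦ v (mem_varsFS.2 ⟨b, hb, ht⟩)]
    intro a ha
    rcases mem_betaRw_ofFn.1 ha with ha | ⟨i, ha⟩
    · exact hfactor _ h htrig hΦB a ha
    · refine hfactor _ (g i) (hmF i) (fun v hv => ?_) a ha
      obtain ⟨b, hb, hvb⟩ := mem_varsFS.1 hv
      rw [(hΦ i).2 _ (mem_termsFS.2 ⟨b, (Finset.mem_sdiff.1 hb).1, hvb⟩)]
      exact (hs i).preimageLabel_of_mem_termsFS (mem_termsFS_applySub (hmF i b hb) hvb)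

lemma FOAtom.applySub_rename (ρ : V → V) (g : FOSubst V C) (a : FOAtom P V C) :
    (a.applySub fun v => FOTerm.var (ρ v)).applySub g = a.applySub (g ∘ ρ) := by
  simp only [FOAtom.applySub, List.map_map, FOAtom.mk.injEq, true_and]
  exact List.map_congr_left fun t _ => by cases t <;> rfl

lemma isHom_rename_iff [DecidableEq P] [DecidableEq V] [DecidableEq C]
    {ρ : V → V} {g : FOSubst V C} {Q F : Finset (FOAtom P V C)} :
    IsHom g (Q.image (FOAtom.applySub fun v => FOTerm.var (ρ v))) F ↔ IsHom (g ∘ ρ) Q F := by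
  simp [IsHom, FOAtom.applySub_rename]

lemma exists_eq_of_mem_varsFS_rename [DecidableEq P] [DecidableEq V] [DecidableEq C]
    {ρ : V → V} {Q : Finset (FOAtom P V C)} {y : V}
    (hy : y ∈ varsFS (Q.image (FOAtom.applySub fun v => FOTerm.var (ρ v)))) : ∃ v, ρ v = y := by
  obtain ⟨a, ha, hya⟩ := mem_varsFS.1 hy
  obtain ⟨b, -, rfl⟩ := Finset.mem_image.1 ha
  obtain ⟨t, -, hty⟩ := List.mem_map.1 hya
  cases t with
  | const c => simp [FOTerm.applySub] at hty
  | var v => exact ⟨v, by simpa [FOTerm.applySub] using hty⟩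

/-- Forward-backward Lemma: for any trigger `(R, h)` on `F`, if
`α_∨(F, R, h) ⊨ 𝒬` then either `F ⊨ 𝒬` or there is a disjunctive piece-unifier
`μ_∨` of `𝒬` with `R` such that `F ⊨ β_∨(𝒬, R, μ_∨)`. -/
theorem stmt6 {P V C : Type} [DecidableEq P] [DecidableEq V] [DecidableEq C] [Infinite V]
    (F : Finset (FOAtom P V C)) (𝒬 : Finset (Finset (FOAtom P V C)))
    (R : DisjRule P V C) (hWF : R.WF)
    (h : FOSubst V C) (htrig : IsTrigger R h F)
    (L : List (Finset (FOAtom P V C))) (hα : IsAlpha F R h L)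
    (hent : ∀ G ∈ L, ∃ Q ∈ 𝒬, EntailsFS G Q) :
    (∃ Q ∈ 𝒬, EntailsFS F Q) ∨
    (∃ μ : DisjPieceUnif P V C,
       IsDisjPieceUnifier (↑𝒬 : Set (Finset (FOAtom P V C))) R μ ∧
       ∃ u : FOSubst V C, IsAssocSub μ.rel u ∧ EntailsFS F (betaRw R μ u)) := by
  refine or_iff_not_imp_left.2 fun hF => ?_
  obtain ⟨hlen, hL⟩ := hα
  have hdisjunct : ∀ i : Fin R.heads.length, ∃ (Q : Finset (FOAtom P V C)) (g h' : FOSubst V C),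
      Q ∈ 𝒬 ∧ IsSafeExt F R (R.heads.get i) h h' ∧
        IsHom g Q (F ∪ applySubFS h' (R.heads.get i)) := by
    intro i
    have hi : i.1 < L.length := i.2.trans_eq hlen.symm
    obtain ⟨h', hs, hLi⟩ := hL i hi i.2
    obtain ⟨Q, hQ, g, hg⟩ := hent _ (List.get_mem L ⟨i, hi⟩)
    rw [hLi] at hg
    exact ⟨Q, g, h', hQ, hs, hg⟩
  choose Q g h' hQ hs hg using hdisjunct
  obtain ⟨ρ, hρ, hρR, hρρ⟩ := exists_fresh_renamings R.vars
  have : Nonempty V := inferInstance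
  have hinv : ∀ i, (g i ∘ Function.invFun (ρ i)) ∘ ρ i = g i := fun i => by
    rw [Function.comp_assoc, Function.invFun_comp (hρ i), Function.comp_id]
  refine exists_disjPieceUnifier_of_copies htrig hs
    (g := fun i => g i ∘ Function.invFun (ρ i))
    (Q := fun i => (Q i).image (FOAtom.applySub fun v => FOTerm.var (ρ i v)))
    (fun i => ⟨Q i, hQ i, ρ i, hρ i, rfl⟩) ?_ ?_ ?_ ?_
  · refine fun i => Finset.disjoint_left.2 fun y hy hyR => ?_
    obtain ⟨v, rfl⟩ := exists_eq_of_mem_varsFS_rename hy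
    exact hρR _ _ hyR
  · refine fun i j hij => Finset.disjoint_left.2 fun y hyi hyj => ?_
    obtain ⟨v, rfl⟩ := exists_eq_of_mem_varsFS_rename hyi
    obtain ⟨w, hw⟩ := exists_eq_of_mem_varsFS_rename hyj
    exact hij (Fin.ext (hρρ _ _ _ _ hw).symm)
  · intro i
    rw [isHom_rename_iff, hinv]
    exact hg i
  · intro i hi
    rw [isHom_rename_iff, hinv] at hi
    exact hF ⟨Q i, hQ i, g i, hi⟩
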